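/- Let S be a set of n points in ℝ³, no three collinear and not all coplanar, and let m be the total number of planes determined by S. Then m₃ + m₄ ≥ (5m + 3n)/8; that is, the planes containing at most four points of S constitute more than five eighths of all determined planes. -/

import Mathlib

open Set

noncomputable section

/-- Three-dimensional euclidean space. -/
abbrev Pt3 := EuclideanSpace ℝ (Fin 3)

/-- A plane in space: the affine span of three affinely independent points. -/
def IsPlane (P : Set Pt3) : Prop :=
  ∃ a b c : Pt3, AffineIndependent ℝ ![a, b, c] ∧
    P = (affineSpan ℝ ({a, b, c} : Set Pt3) : Set Pt3)

/-- `planeCount S k` is the number of planes containing exactly `k` points of `S`. -/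
def planeCount (S : Set Pt3) (k : ℕ) : ℕ :=
  {P : Set Pt3 | IsPlane P ∧ (S ∩ P).ncard = k}.ncard

/-- The planes determined by `S`: planes containing at least three points of `S`. -/
def detPlanes (S : Set Pt3) : Set (Set Pt3) :=
  {P : Set Pt3 | IsPlane P ∧ 3 ≤ (S ∩ P).ncard}

/-- No three points of `S` are collinear. -/
def NoThreeCollinear (S : Set Pt3) : Prop :=
  ∀ T ⊆ S, T.ncard = 3 → ¬ Collinear ℝ T

namespace Melchior

variable {ι : Type*}

/-- Twice the signed area of the triangle on the points `(x i, y i)`, `i = a, b, c`. -/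
def orient (x y : ι → ℝ) (a b c : ι) : ℝ :=
  (x b - x a) * (y c - y a) - (y b - y a) * (x c - x a)

/-- The points of `T` on the line through the points `a` and `b`. -/
noncomputable def lineThrough (x y : ι → ℝ) (T : Finset ι) (a b : ι) : Finset ι :=
  {c ∈ T | orient x y a b c = 0}

/-- The lines determined by `T`, as sets of points of `T`. -/
noncomputable def lines [DecidableEq ι] (x y : ι → ℝ) (T : Finset ι) : Finset (Finset ι) :=
  T.offDiag.image fun ab ↦ lineThrough x y T ab.1 ab.2

/-- The cotangent of the angle at `m` between the directions to `r` and to `z`. -/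
noncomputable def cot (x y : ι → ℝ) (m z r : ι) : ℝ :=
  ((x r - x m) * (x z - x m) + (y r - y m) * (y z - y m)) / orient x y m r z


variable {x y : ι → ℝ} {T : Finset ι}

theorem cot_lt_cot_swap {m z r : ι} (hmz : x m ≠ x z) (h : orient x y m r z < 0) :
    cot x y m z r < cot x y z m r := by
  have h1 : orient x y z r m = - orient x y m r z := by unfold orient; ring
  have h2 : cot x y z m r - cot x y m z r =
      ((x z - x m) ^ 2 + (y z - y m) ^ 2) / (- orient x y m r z) := by
    unfold cot
    rw [h1]
    field_simp
    ring
  have h3 : 0 < (x z - x m) ^ 2 := by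
    have := sub_ne_zero.2 hmz.symm
    positivity
  have : 0 < ((x z - x m) ^ 2 + (y z - y m) ^ 2) / (- orient x y m r z) :=
    div_pos (by positivity) (by linarith)
  linarith

theorem cot_sub_cot {m z r s : ι} (hr : orient x y m r z ≠ 0) (hs : orient x y m s z ≠ 0) :
    cot x y m z r - cot x y m z s =
      ((x z - x m) ^ 2 + (y z - y m) ^ 2) * orient x y m s r /
        (orient x y m r z * orient x y m s z) := by
  unfold cot
  rw [div_sub_div _ _ hr hs]
  unfold orient
  congr 1
  ring

/-- `IsPivot m z r` says that, when the line through the consecutive points `m` and `z` is rotated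
clockwise about both of them at the same speed, then `r` is among the points which are met first,
and this happens on the line rotated about `m`. -/
structure IsPivot (x y : ι → ℝ) (T : Finset ι) (m z r : ι) : Prop where
  mem : r ∈ T
  pos : 0 < orient x y m r z
  extreme : ∀ s ∈ T, orient x y m r s = 0 → 0 ≤ (x s - x m) * (x r - x m)
  first : ∀ s ∈ T, 0 ≤ orient x y m s r * orient x y m s z

theorem isPivot_of_cot_le {m z r : ι} (hx : Set.InjOn x T) (hm : m ∈ T) (hz : z ∈ T) (hmz : m ≠ z)
    (hr : r ∈ T) (hr0 : orient x y m r z ≠ 0)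
    (h1 : ∀ s ∈ T, orient x y m s z ≠ 0 → cot x y m z s ≤ cot x y m z r)
    (h2 : ∀ s ∈ T, orient x y m s z ≠ 0 → cot x y z m s ≤ cot x y m z r) :
    IsPivot x y T m z r := by
  have hxmz : x m ≠ x z := fun h ↦ hmz (hx hm hz h)
  have hsq : 0 < (x z - x m) ^ 2 + (y z - y m) ^ 2 := by
    have := sub_ne_zero.2 hxmz.symm
    positivity
  have hpos : ∀ s ∈ T, orient x y m s z ≠ 0 → cot x y m z s = cot x y m z r →
      0 < orient x y m s z := by
    intro s hs hs0 he
    by_contra! hneg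
    have := cot_lt_cot_swap hxmz (lt_of_le_of_ne hneg hs0)
    linarith [h2 s hs hs0]
  have hrp := hpos r hr hr0 rfl
  refine ⟨hr, hrp, fun s hs hs0 ↦ ?_, fun s hs ↦ ?_⟩
  · by_cases hxs : x s = x m
    · simp [hxs]
    have key : (x r - x m) * orient x y m s z = (x s - x m) * orient x y m r z := by
      unfold orient at *
      linear_combination -(x z - x m) * hs0
    have hxr : x r - x m ≠ 0 := by
      intro h
      have : (x s - x m) * orient x y m r z = 0 := by rw [← key, h, zero_mul]
      exact (mul_ne_zero (sub_ne_zero.2 hxs) hr0) this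
    have hs1 : orient x y m s z ≠ 0 := by
      intro h
      rw [h, mul_zero] at key
      exact (mul_ne_zero (sub_ne_zero.2 hxs) hr0) key.symm
    have hc := cot_sub_cot hr0 hs1
    have : orient x y m s r = 0 := by unfold orient at *; linarith
    rw [this] at hc
    have hsp := hpos s hs hs1 (by simp at hc; linarith)
    have : 0 ≤ ((x s - x m) * (x r - x m)) * orient x y m r z := by
      have : ((x s - x m) * (x r - x m)) * orient x y m r z =
        (x r - x m) ^ 2 * orient x y m s z := by linear_combination -(x r - x m) * key
      rw [this]; positivity
    exact nonneg_of_mul_nonneg_left this hrp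
  · by_cases hs0 : orient x y m s z = 0
    · simp [hs0]
    have hc := cot_sub_cot hr0 hs0
    have h := h1 s hs hs0
    have h0 : 0 ≤ ((x z - x m) ^ 2 + (y z - y m) ^ 2) * orient x y m s r /
        (orient x y m r z * orient x y m s z) := by linarith
    have h3 : orient x y m s r * orient x y m s z =
        (((x z - x m) ^ 2 + (y z - y m) ^ 2) * orient x y m s r /
        (orient x y m r z * orient x y m s z)) * (orient x y m r z * orient x y m s z ^ 2)
         / ((x z - x m) ^ 2 + (y z - y m) ^ 2) := by
      field_simp
    rw [h3]
    positivity

theorem exists_isPivot {p q : ι} (hx : Set.InjOn x T) (hp : p ∈ T) (hq : q ∈ T) (hpq : p ≠ q)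
    (hT : ∃ r ∈ T, orient x y p q r ≠ 0) :
    ∃ m z r, (m = p ∧ z = q ∨ m = q ∧ z = p) ∧ IsPivot x y T m z r := by
  have e1 (s) : orient x y p s q = - orient x y p q s := by unfold orient; ring
  have e2 (s) : orient x y q s p = orient x y p q s := by unfold orient; ring
  obtain ⟨r, hr, hmax⟩ := ({r ∈ T | orient x y p q r ≠ 0} : Finset ι).exists_max_image
    (fun r ↦ max (cot x y p q r) (cot x y q p r)) (by simpa [Finset.Nonempty] using hT)
  simp only [Finset.mem_filter, and_imp] at hr hmax
  rcases le_total (cot x y q p r) (cot x y p q r) with h | h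
  · refine ⟨p, q, r, by simp, isPivot_of_cot_le hx hp hq hpq hr.1 (by simpa [e1] using hr.2) ?_ ?_⟩
    all_goals
      intro s hs hs0
      have := hmax s hs (by simpa [e1] using hs0)
      rw [max_eq_left h, max_le_iff] at this
      tauto
  · refine ⟨q, p, r, by simp,
      isPivot_of_cot_le hx hq hp hpq.symm hr.1 (by simpa [e2] using hr.2) ?_ ?_⟩
    all_goals
      intro s hs hs0
      have := hmax s hs (by simpa [e2] using hs0)
      rw [max_eq_right h, max_le_iff] at this
      tauto

theorem orient_eq_mul_of_mem {a b m r : ι} (z : ι) (hm : orient x y a b m = 0)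
    (hr : orient x y a b r = 0) :
    (x b - x a) * orient x y m r z = (x r - x m) * orient x y a b z := by
  unfold orient at *
  linear_combination -(x r - x m) * hm - (x z - x m) * (hr - hm)

theorem lineThrough_eq {a b m r : ι} (hab : x a ≠ x b) (hmr : x m ≠ x r)
    (hm : orient x y a b m = 0) (hr : orient x y a b r = 0) :
    lineThrough x y T m r = lineThrough x y T a b := by
  ext z
  have := orient_eq_mul_of_mem z hm hr
  have h1 := sub_ne_zero.2 hab.symm
  have h2 := sub_ne_zero.2 hmr.symm
  simp only [lineThrough, Finset.mem_filter, and_congr_right_iff]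
  intro _
  constructor <;> intro h <;> rw [h, mul_zero] at this <;> simp_all

theorem IsPivot.unique {m z r m' z' r' : ι} (hx : Set.InjOn x T) (hm : m ∈ T) (hm' : m' ∈ T)
    (hz : z ∈ T) (hz' : z' ∈ T)
    (hc : ∀ s ∈ T, orient x y m z s = 0 → 0 < (x s - x m) * (x z - x m) →
      0 ≤ (x s - x z) * (x z - x m))
    (hc' : ∀ s ∈ T, orient x y m' z' s = 0 → 0 < (x s - x m') * (x z' - x m') →
      0 ≤ (x s - x z') * (x z' - x m'))
    (h : IsPivot x y T m z r) (h' : IsPivot x y T m' z' r')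
    (hl : lineThrough x y T m r = lineThrough x y T m' r') (hlt : x m < x r ↔ x m' < x r') :
    m = m' ∧ z = z' := by
  have orient_self (a b) : orient x y a b a = 0 := by unfold orient; ring
  have orient_self' (a b) : orient x y a b b = 0 := by unfold orient; ring
  have orient_self'' (a b) : orient x y a a b = 0 := by unfold orient; ring
  have swap (a b c) : orient x y a b c = - orient x y a c b := by unfold orient; ring
  have ne_of_pos {m r z} (hm : m ∈ T) (hr : r ∈ T) (h : 0 < orient x y m r z) : x m ≠ x r := by
    intro he
    rw [hx hm hr he, orient_self''] at h
    exact lt_irrefl _ h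
  have mem_iff (s) (hs : s ∈ T) : orient x y m r s = 0 ↔ orient x y m' r' s = 0 := by
    have := Finset.ext_iff.1 hl s
    simpa [lineThrough, hs] using this
  have hmr := ne_of_pos hm h.mem h.pos
  have hmr' := ne_of_pos hm' h'.mem h'.pos
  have hmm : m = m' := by
    apply hx hm hm'
    have h1 := h.extreme m' hm' ((mem_iff m' hm').2 (orient_self _ _))
    have h2 := h'.extreme m hm ((mem_iff m hm).1 (orient_self _ _))
    rcases lt_or_gt_of_ne hmr with h3 | h3
    · have h4 := hlt.1 h3
      exact le_antisymm (by linarith [nonneg_of_mul_nonneg_left h1 (sub_pos.2 h3)])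
        (by linarith [nonneg_of_mul_nonneg_left h2 (sub_pos.2 h4)])
    · have h4 : x r' < x m' := lt_of_le_of_ne (not_lt.1 (mt hlt.2 h3.le.not_gt)) hmr'.symm
      apply le_antisymm
      · nlinarith
      · nlinarith
  subst hmm
  refine ⟨rfl, ?_⟩
  have hr' : orient x y m r r' = 0 := (mem_iff r' h'.mem).2 (orient_self' _ _)
  have hside := h.extreme r' h'.mem hr'
  have hside : 0 < (x r' - x m) * (x r - x m) :=
    lt_of_le_of_ne hside
      (mul_ne_zero (sub_ne_zero.2 hmr'.symm) (sub_ne_zero.2 hmr.symm)).symm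
  have same {z} (hz : 0 < orient x y m r' z) : 0 < orient x y m r z := by
    have h1 := orient_eq_mul_of_mem z (orient_self m r) hr'
    have h2 : 0 < ((x r' - x m) * (x r - x m)) * orient x y m r z := by
      have : ((x r' - x m) * (x r - x m)) * orient x y m r z =
        (x r - x m) ^ 2 * orient x y m r' z := by linear_combination -(x r - x m) * h1
      rw [this]
      have := sub_ne_zero.2 hmr.symm
      positivity
    exact pos_of_mul_pos_right h2 hside.le
  have same' {z} (hz : 0 < orient x y m r z) : 0 < orient x y m r' z := by
    have h1 := orient_eq_mul_of_mem z (orient_self m r) hr'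
    have h2 : 0 < (x r - x m) ^ 2 * orient x y m r' z := by
      have : ((x r' - x m) * (x r - x m)) * orient x y m r z =
        (x r - x m) ^ 2 * orient x y m r' z := by linear_combination -(x r - x m) * h1
      rw [← this]
      positivity
    exact pos_of_mul_pos_right h2 (sq_nonneg _)
  have h1 : orient x y m z' z ≤ 0 := by
    have h2 := h.first z' hz'
    have h3 := same h'.pos
    rw [swap m z' r] at h2
    nlinarith
  have h2 : orient x y m z z' ≤ 0 := by
    have h2 := h'.first z hz
    have h3 := same' h.pos
    rw [swap m z r'] at h2
    nlinarith
  have h3 : orient x y m z z' = 0 := by rw [swap m z' z] at h1; linarith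
  have h4 : orient x y m z' z = 0 := by rw [swap, h3, neg_zero]
  have h5 : 0 < orient x y m r z' := same h'.pos
  have hzm : x m ≠ x z := by
    intro he
    have := h.pos
    rw [← hx hm hz he, orient_self] at this
    exact lt_irrefl _ this
  have h6 : 0 < (x z - x m) * (x z' - x m) := by
    have h7 : (x z' - x m) * orient x y m r z = (x z - x m) * orient x y m r z' := by
      unfold orient at *
      linear_combination -(x r - x m) * h3
    have h8 : 0 < ((x z - x m) * (x z' - x m)) * orient x y m r z := by
      have : ((x z - x m) * (x z' - x m)) * orient x y m r z =
        (x z - x m) ^ 2 * orient x y m r z' := by linear_combination (x z - x m) * h7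
      rw [this]
      have := sub_ne_zero.2 hzm.symm
      positivity
    exact pos_of_mul_pos_left h8 h.pos.le
  have h7 := hc z' hz' h3 (by linarith)
  have h8 := hc' z hz h4 h6
  apply hx hz hz'
  rcases pos_and_pos_or_neg_and_neg_of_mul_pos h6 with ⟨h9, h10⟩ | ⟨h9, h10⟩
  · exact le_antisymm (by linarith [nonneg_of_mul_nonneg_left h7 h9])
      (by linarith [nonneg_of_mul_nonneg_left h8 h10])
  · apply le_antisymm
    · nlinarith
    · nlinarith

/-- Pairs of points, in increasing order, which are consecutive among the points of `T` on the
line through them. -/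
noncomputable def consecutivePairs (x y : ι → ℝ) (T : Finset ι) : Finset (ι × ι) :=
  {pq ∈ T ×ˢ T | x pq.1 < x pq.2 ∧
    ∀ s ∈ T, orient x y pq.1 pq.2 s = 0 → ¬ (x pq.1 < x s ∧ x s < x pq.2)}

theorem lineThrough_mem_lines [DecidableEq ι] {a b : ι} (ha : a ∈ T) (hb : b ∈ T)
    (hab : x a ≠ x b) : lineThrough x y T a b ∈ lines x y T :=
  Finset.mem_image.2 ⟨(a, b), by simpa [ha, hb] using fun h ↦ hab (congrArg x h), rfl⟩

theorem sum_card_lines_le [DecidableEq ι] (hx : Set.InjOn x T) :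
    ∑ l ∈ lines x y T, (l.card - 1) ≤ (consecutivePairs x y T).card := by
  rw [Finset.card_eq_sum_card_fiberwise (t := lines x y T)
    (f := fun pq ↦ lineThrough x y T pq.1 pq.2)]
  · refine Finset.sum_le_sum fun l hl ↦ ?_
    obtain ⟨⟨a, b⟩, hab, rfl⟩ := Finset.mem_image.1 hl
    simp only [Finset.mem_offDiag] at hab
    obtain ⟨ha, hb, hab⟩ := hab
    have hxab : x a ≠ x b := fun h ↦ hab (hx ha hb h)
    simp only
    set l := lineThrough x y T a b with hldef
    have hal : a ∈ l := by
      simp only [hldef, lineThrough, Finset.mem_filter, ha, true_and]; unfold orient; ring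
    have memT {s} (hs : s ∈ l) : s ∈ T := (Finset.mem_filter.1 hs).1
    have mem0 {s} (hs : s ∈ l) : orient x y a b s = 0 := (Finset.mem_filter.1 hs).2
    obtain ⟨c, hc, hmin⟩ := l.exists_min_image x ⟨a, hal⟩
    rw [← Finset.card_erase_of_mem hc]
    refine le_trans (Finset.card_le_card ?_) (Finset.card_image_le (f := Prod.snd))
    intro q hq
    obtain ⟨hqc, hq⟩ := Finset.mem_erase.1 hq
    have hcq : x c < x q :=
      lt_of_le_of_ne (hmin q hq) fun h ↦ hqc (hx (memT hq) (memT hc) h.symm)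
    obtain ⟨p, hp, hmax⟩ := ({p ∈ l | x p < x q} : Finset ι).exists_max_image x
      ⟨c, by simp [hc, hcq]⟩
    simp only [Finset.mem_filter, and_imp] at hp hmax
    have hpq := lineThrough_eq (T := T) hxab hp.2.ne (mem0 hp.1) (mem0 hq)
    refine Finset.mem_image.2 ⟨(p, q), ?_, rfl⟩
    simp only [consecutivePairs, Finset.mem_filter, Finset.mem_product, memT hp.1, memT hq, hp.2,
      true_and]
    refine ⟨fun s hs hs0 h ↦ ?_, hpq⟩
    have hsl : s ∈ l := by
      rw [hldef, ← hpq]; exact Finset.mem_filter.2 ⟨hs, hs0⟩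
    exact (hmax s hsl h.2).not_gt h.1
  · intro pq hpq
    simp only [consecutivePairs, Finset.coe_filter, Finset.mem_product, Set.mem_ofPred_eq] at hpq
    exact lineThrough_mem_lines hpq.1.1 hpq.1.2 hpq.2.1.ne

/-- A line is an upper edge of the convex hull if all points lie weakly below it. -/
def IsUpperEdge (x y : ι → ℝ) (T : Finset ι) (l : Finset ι) : Prop :=
  ∃ a ∈ T, ∃ c ∈ T, x a < x c ∧ l = lineThrough x y T a c ∧ ∀ z ∈ T, orient x y a c z ≤ 0

theorem exists_forall_orient_nonpos {a b : ι} (hb : b ∈ T)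
    (hab : a ≠ b) (hmin : ∀ z ∈ T, z ≠ a → x a < x z) :
    ∃ c ∈ T, x a < x c ∧ ∀ z ∈ T, orient x y a c z ≤ 0 := by
  classical
  obtain ⟨c, hc, hmax⟩ := (T.erase a).exists_max_image (fun z ↦ (y z - y a) / (x z - x a))
    ⟨b, by simp [hb, hab.symm]⟩
  simp only [Finset.mem_erase, and_imp, ne_eq] at hc hmax
  have hac := hmin c hc.2 hc.1
  refine ⟨c, hc.2, hac, fun z hz ↦ ?_⟩
  by_cases hza : z = a
  · subst hza; unfold orient; simp
  have h := hmax z hza hz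
  rw [div_le_div_iff₀ (sub_pos.2 (hmin z hz hza)) (sub_pos.2 hac)] at h
  unfold orient
  linarith

theorem orient_neg_left (a b c : ι) : orient (-x) y a b c = - orient x y a b c := by
  simp only [orient, Pi.neg_apply]; ring

theorem orient_neg_right (a b c : ι) : orient x (-y) a b c = - orient x y a b c := by
  simp only [orient, Pi.neg_apply]; ring

theorem lineThrough_neg_right (a b : ι) : lineThrough x (-y) T a b = lineThrough x y T a b := by
  simp [lineThrough, orient_neg_right]

theorem lines_neg_right [DecidableEq ι] : lines x (-y) T = lines x y T := by
  simp [lines, lineThrough_neg_right]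

theorem exists_isUpperEdge [DecidableEq ι] {a b : ι} (ha : a ∈ T) (hb : b ∈ T)
    (hab : a ≠ b) (hmin : ∀ z ∈ T, z ≠ a → x a < x z) (hmax : ∀ z ∈ T, z ≠ b → x z < x b) :
    (∃ l ∈ lines x y T, ∃ l' ∈ lines x y T, l ≠ l' ∧ IsUpperEdge x y T l ∧ IsUpperEdge x y T l') ∨
    (∃ l ∈ lines x y T, IsUpperEdge x y T l) ∧ ∀ z ∈ T, orient x y a b z ≤ 0 := by
  obtain ⟨c, hc, hac, h⟩ := exists_forall_orient_nonpos (y := y) hb hab hmin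
  obtain ⟨d, hd, hbd, h'⟩ := exists_forall_orient_nonpos (x := -x) (y := y) ha hab.symm
    (by simpa using hmax)
  simp only [Pi.neg_apply, neg_lt_neg_iff, orient_neg_left] at hbd h'
  have hl : IsUpperEdge x y T (lineThrough x y T a c) := ⟨a, ha, c, hc, hac, rfl, h⟩
  have hlm := lineThrough_mem_lines (y := y) ha hc hac.ne
  have orient_self (a b) : orient x y a b a = 0 := by unfold orient; ring
  have orient_self' (a b) : orient x y a b b = 0 := by unfold orient; ring
  have hl' : IsUpperEdge x y T (lineThrough x y T d b) := by
    refine ⟨d, hd, b, hb, hbd, rfl, fun z hz ↦ ?_⟩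
    have h1 : orient x y d b z = - orient x y b d z := by unfold orient; ring
    rw [h1]
    exact h' z hz
  have hlm' := lineThrough_mem_lines (y := y) hd hb hbd.ne
  by_cases heq : lineThrough x y T a c = lineThrough x y T d b
  · right
    refine ⟨⟨_, hlm, hl⟩, fun z hz ↦ ?_⟩
    have hbl : b ∈ lineThrough x y T a c := by
      rw [heq]; exact Finset.mem_filter.2 ⟨hb, orient_self' _ _⟩
    have h1 := orient_eq_mul_of_mem z (orient_self a c) (Finset.mem_filter.1 hbl).2
    have h2 := h z hz
    have h3 : x a < x b := hmin b hb hab.symm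
    have h4 : (x c - x a) * orient x y a b z ≤ 0 := by
      rw [h1]; exact mul_nonpos_of_nonneg_of_nonpos (by linarith) h2
    exact nonpos_of_mul_nonpos_right h4 (by linarith)
  · exact .inl ⟨_, hlm, _, hlm', heq, hl, hl'⟩

/-- **Melchior's inequality**: if `T` is a finite set of points in the plane, not all collinear,
and `t k` is the number of lines containing exactly `k` points of `T`, then
`3 + ∑ k, (k - 3) * t k ≤ 0`. -/
theorem melchior [DecidableEq ι] (hx : Set.InjOn x T)
    (hT : ∃ a ∈ T, ∃ b ∈ T, ∃ c ∈ T, orient x y a b c ≠ 0) :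
    ∑ l ∈ lines x y T, (l.card - 1) + 3 ≤ 2 * (lines x y T).card := by
  classical
  obtain ⟨a₀, ha₀, b₀, hb₀, c₀, hc₀, h₀⟩ := hT
  have orient_self (a b) : orient x y a b a = 0 := by unfold orient; ring
  have orient_self' (a b) : orient x y a b b = 0 := by unfold orient; ring
  have orient_self'' (a b) : orient x y a a b = 0 := by unfold orient; ring
  have hoff : ∀ p ∈ T, ∀ q ∈ T, p ≠ q → ∃ r ∈ T, orient x y p q r ≠ 0 := by
    intro p hp q hq hpq
    by_contra! hall
    have hpq' : x q - x p ≠ 0 := fun h ↦ hpq (hx hp hq (by linarith))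
    have h1 := orient_eq_mul_of_mem c₀ (hall a₀ ha₀) (hall b₀ hb₀)
    rw [hall c₀ hc₀, mul_zero] at h1
    exact (mul_ne_zero hpq' h₀) h1
  have hmem {pq : ι × ι} (h : pq ∈ consecutivePairs x y T) : pq.1 ∈ T ∧ pq.2 ∈ T ∧
      x pq.1 < x pq.2 ∧
      ∀ s ∈ T, orient x y pq.1 pq.2 s = 0 → ¬ (x pq.1 < x s ∧ x s < x pq.2) := by
    simpa [consecutivePairs, and_assoc] using h
  have hex : ∀ pq : ι × ι, ∃ mzr : ι × ι × ι, pq ∈ consecutivePairs x y T →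
      (mzr.1 = pq.1 ∧ mzr.2.1 = pq.2 ∨ mzr.1 = pq.2 ∧ mzr.2.1 = pq.1) ∧
        IsPivot x y T mzr.1 mzr.2.1 mzr.2.2 := by
    intro pq
    by_cases h : pq ∈ consecutivePairs x y T
    · obtain ⟨hp, hq, hlt, -⟩ := hmem h
      have hne : pq.1 ≠ pq.2 := fun h ↦ hlt.ne (congrArg x h)
      obtain ⟨m, z, r, h⟩ := exists_isPivot hx hp hq hne (hoff _ hp _ hq hne)
      exact ⟨(m, z, r), fun _ ↦ h⟩
    · exact ⟨(pq.1, pq.1, pq.1), fun h' ↦ (h h').elim⟩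
  choose f hf using hex
  let g : ι × ι → Finset ι × Bool := fun pq ↦
    (lineThrough x y T (f pq).1 (f pq).2.2, decide (x (f pq).1 < x (f pq).2.2))
  have hfm {pq} (h : pq ∈ consecutivePairs x y T) : (f pq).1 ∈ T ∧ (f pq).2.1 ∈ T := by
    have h1 := (hf pq h).1
    have h2 := hmem h
    rcases h1 with h1 | h1 <;> rw [h1.1, h1.2] <;> tauto
  have hfc {pq} (h : pq ∈ consecutivePairs x y T) : ∀ s ∈ T, orient x y (f pq).1 (f pq).2.1 s = 0 →
      0 < (x s - x (f pq).1) * (x (f pq).2.1 - x (f pq).1) →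
      0 ≤ (x s - x (f pq).2.1) * (x (f pq).2.1 - x (f pq).1) := by
    intro s hs hs0 hpos
    obtain ⟨-, -, hlt, hc⟩ := hmem h
    have hc := hc s hs
    rcases (hf pq h).1 with h1 | h1 <;> rw [h1.1, h1.2] at hs0 hpos ⊢
    · have h2 : x pq.1 < x s := by
        linarith [pos_of_mul_pos_left hpos (by linarith)]
      have h3 : x pq.2 ≤ x s := not_lt.1 fun h ↦ hc hs0 ⟨h2, h⟩
      exact mul_nonneg (by linarith) (by linarith)
    · have h2 : x s < x pq.2 := by nlinarith
      have h3 : x s ≤ x pq.1 := not_lt.1 fun h ↦ hc (by unfold orient at *; linarith) ⟨h, h2⟩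
      exact mul_nonneg_of_nonpos_of_nonpos (by linarith) (by linarith)
  have hne {pq} (h : pq ∈ consecutivePairs x y T) : x (f pq).1 ≠ x (f pq).2.2 := by
    intro he
    have h1 := (hf pq h).2
    have h2 := h1.pos
    rw [hx (hfm h).1 h1.mem he, orient_self''] at h2
    exact lt_irrefl _ h2
  have hginj : Set.InjOn g (consecutivePairs x y T) := by
    intro pq hpq pq' hpq' hgg
    simp only [Finset.mem_coe] at hpq hpq'
    simp only [g, Prod.mk.injEq, decide_eq_decide] at hgg
    obtain ⟨h1, h2⟩ := IsPivot.unique hx (hfm hpq).1 (hfm hpq').1 (hfm hpq).2 (hfm hpq').2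
      (hfc hpq) (hfc hpq') (hf pq hpq).2 (hf pq' hpq').2 hgg.1 hgg.2
    have h3 := (hmem hpq).2.2.1
    have h4 := (hmem hpq').2.2.1
    rcases (hf pq hpq).1 with h5 | h5 <;> rcases (hf pq' hpq').1 with h6 | h6 <;>
      rw [h5.1, h6.1] at h1 <;> rw [h5.2, h6.2] at h2
    · exact Prod.ext h1 h2
    · rw [h1, h2] at h3; exact (lt_asymm h3 h4).elim
    · rw [h1, h2] at h3; exact (lt_asymm h3 h4).elim
    · exact Prod.ext h2 h1
  let H : Finset (Finset ι × Bool) := {lb ∈ lines x y T ×ˢ Finset.univ |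
    lb.2 = true ∧ IsUpperEdge x y T lb.1 ∨ lb.2 = false ∧ IsUpperEdge x (-y) T lb.1}
  have hdisj : Disjoint ((consecutivePairs x y T).image g) H := by
    rw [Finset.disjoint_left]
    intro lb hlb hH
    obtain ⟨pq, hpq, rfl⟩ := Finset.mem_image.1 hlb
    have hpos := (hf pq hpq).2.pos
    have hz := (hfm hpq).2
    have key {a c} (hl : lineThrough x y T (f pq).1 (f pq).2.2 = lineThrough x y T a c) :
        (x c - x a) * orient x y (f pq).1 (f pq).2.2 (f pq).2.1 =
        (x (f pq).2.2 - x (f pq).1) * orient x y a c (f pq).2.1 := by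
      apply orient_eq_mul_of_mem
      · have : (f pq).1 ∈ lineThrough x y T a c := by
          rw [← hl]; exact Finset.mem_filter.2 ⟨(hfm hpq).1, orient_self _ _⟩
        exact (Finset.mem_filter.1 this).2
      · have : (f pq).2.2 ∈ lineThrough x y T a c := by
          rw [← hl]; exact Finset.mem_filter.2 ⟨(hf pq hpq).2.mem, orient_self' _ _⟩
        exact (Finset.mem_filter.1 this).2
    rcases (Finset.mem_filter.1 hH).2 with ⟨hb, a, ha, c, hc, hac, hl, hall⟩ |
      ⟨hb, a, ha, c, hc, hac, hl, hall⟩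
    · have hlt : x (f pq).1 < x (f pq).2.2 := of_decide_eq_true hb
      have h1 := key hl
      have h2 := mul_pos (sub_pos.2 hac) hpos
      have h3 := mul_nonpos_of_nonneg_of_nonpos (sub_pos.2 hlt).le (hall _ hz)
      linarith
    · have hlt : ¬ x (f pq).1 < x (f pq).2.2 := of_decide_eq_false hb
      rw [lineThrough_neg_right] at hl
      have h1 := key hl
      have h2 := mul_pos (sub_pos.2 hac) hpos
      have h4 := hall _ hz
      rw [orient_neg_right] at h4
      have h3 := mul_nonpos_of_nonpos_of_nonneg (sub_nonpos.2 (not_lt.1 hlt)) (neg_nonpos.1 h4)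
      linarith
  have hH : 3 ≤ H.card := by
    obtain ⟨a, ha, hmin⟩ := T.exists_min_image x ⟨a₀, ha₀⟩
    obtain ⟨b, hb, hmax⟩ := T.exists_max_image x ⟨a₀, ha₀⟩
    have hmin' : ∀ z ∈ T, z ≠ a → x a < x z := fun z hz hza ↦
      lt_of_le_of_ne (hmin z hz) fun h ↦ hza (hx hz ha h.symm)
    have hmax' : ∀ z ∈ T, z ≠ b → x z < x b := fun z hz hza ↦
      lt_of_le_of_ne (hmax z hz) fun h ↦ hza (hx hz hb h)
    have hab : a ≠ b := by
      rintro rfl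
      have : ∀ z ∈ T, z = a := fun z hz ↦ hx hz ha (le_antisymm (hmax z hz) (hmin z hz))
      rw [this a₀ ha₀, this b₀ hb₀, orient_self''] at h₀
      exact h₀ rfl
    have memU {l} (h : l ∈ lines x y T) (h' : IsUpperEdge x y T l) : (l, true) ∈ H := by
      simp [H, h, h']
    have memL {l} (h : l ∈ lines x y T) (h' : IsUpperEdge x (-y) T l) : (l, false) ∈ H := by
      simp [H, h, h']
    have hU := exists_isUpperEdge (y := y) ha hb hab hmin' hmax'
    have hL := exists_isUpperEdge (y := -y) ha hb hab hmin' hmax'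
    simp only [lines_neg_right, orient_neg_right] at hL
    apply Finset.two_lt_card.2
    have hL' : ∃ l ∈ lines x y T, IsUpperEdge x (-y) T l := by
      rcases hL with ⟨l, hl, -, -, -, h, -⟩ | h
      exacts [⟨l, hl, h⟩, h.1]
    rcases hU with ⟨l, hl, l', hl', hne, h, h'⟩ | ⟨⟨l, hl, h⟩, hU⟩
    · obtain ⟨k, hk, h''⟩ := hL'
      exact ⟨_, memU hl h, _, memU hl' h', _, memL hk h'', by simpa using hne, by simp, by simp⟩
    · rcases hL with ⟨k, hk, k', hk', hne, h1, h2⟩ | ⟨-, hL⟩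
      · exact ⟨_, memL hk h1, _, memL hk' h2, _, memU hl h, by simpa using hne, by simp, by simp⟩
      · obtain ⟨r, hr, h⟩ := hoff a ha b hb hab
        exact (h (by linarith [hU r hr, hL r hr])).elim
  have hsub : (consecutivePairs x y T).image g ∪ H ⊆ lines x y T ×ˢ Finset.univ := by
    refine Finset.union_subset ?_ (Finset.filter_subset _ _)
    intro lb hlb
    obtain ⟨pq, hpq, rfl⟩ := Finset.mem_image.1 hlb
    simp only [Finset.mem_product, Finset.mem_univ, and_true]
    exact lineThrough_mem_lines (hfm hpq).1 (hf pq hpq).2.mem (hne hpq)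
  have hcard := Finset.card_le_card hsub
  rw [Finset.card_union_of_disjoint hdisj, Finset.card_image_of_injOn hginj, Finset.card_product,
    Finset.card_univ, Fintype.card_bool] at hcard
  have := sum_card_lines_le (y := y) hx
  omega

end Melchior

/-- The determinant of three vectors in space. -/
def det3 (u v w : Pt3) : ℝ :=
  u 0 * (v 1 * w 2 - v 2 * w 1) - u 1 * (v 0 * w 2 - v 2 * w 0) + u 2 * (v 0 * w 1 - v 1 * w 0)

/-- The dot product of two vectors in space. -/
def dot3 (u v : Pt3) : ℝ := u 0 * v 0 + u 1 * v 1 + u 2 * v 2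

theorem dot3_self_pos {u : Pt3} (hu : u ≠ 0) : 0 < dot3 u u := by
  by_contra! h
  unfold dot3 at h
  apply hu
  ext i
  fin_cases i <;> simp <;> nlinarith [mul_self_nonneg (u 0), mul_self_nonneg (u 1),
    mul_self_nonneg (u 2)]

theorem exists_dot3_ne_zero {ι : Type*} [Finite ι] (v : ι → Pt3) (hv : ∀ i, v i ≠ 0) :
    ∃ u, ∀ i, dot3 u (v i) ≠ 0 := by
  obtain ⟨u, hu⟩ := Module.Dual.exists_forall_ne_zero_of_forall_exists
    (fun i ↦ innerₛₗ ℝ (v i)) fun i ↦ ⟨v i, by simpa using hv i⟩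
  refine ⟨u, fun i ↦ ?_⟩
  have := hu i
  simpa [PiLp.inner_apply, Fin.sum_univ_three, dot3] using this

theorem collinear_of_smul_sub_eq {p a b : Pt3} {r s : ℝ} (hr : r ≠ 0)
    (h : r • (b - p) = s • (a - p)) : Collinear ℝ {p, a, b} := by
  refine (collinear_iff_of_mem (p₀ := p) (by simp)).2 ⟨a - p, ?_⟩
  have hb : b = (r⁻¹ * s) • (a - p) +ᵥ p := by
    rw [mul_smul, ← h, smul_smul, inv_mul_cancel₀ hr]; simp
  simp only [mem_insert_iff, mem_singleton_iff, forall_eq_or_imp, forall_eq]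
  exact ⟨⟨0, by simp⟩, ⟨1, by simp⟩, ⟨_, hb⟩⟩

theorem mem_affineSpan_triple_iff {p a b : Pt3} (h : ¬ Collinear ℝ {p, a, b}) (s : Pt3) :
    s ∈ affineSpan ℝ {p, a, b} ↔ det3 (a - p) (b - p) (s - p) = 0 := by
  have hp : p ∈ affineSpan ℝ {p, a, b} := subset_affineSpan ℝ _ (by simp)
  have h1 : s ∈ affineSpan ℝ {p, a, b} ↔ s - p ∈ Submodule.span ℝ {a - p, b - p} := by
    rw [← AffineSubspace.vsub_right_mem_direction_iff_mem hp, direction_affineSpan,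
      vectorSpan_eq_span_vsub_set_right ℝ (show p ∈ ({p, a, b} : Set Pt3) by simp)]
    simp [image_insert_eq]
  rw [h1, Submodule.mem_span_pair]
  constructor
  · rintro ⟨c, d, hcd⟩
    rw [← hcd]
    simp only [det3, PiLp.add_apply, PiLp.smul_apply, smul_eq_mul]
    ring
  · intro hdet
    have hu : a - p ≠ 0 := by
      intro h0
      rw [sub_eq_zero.1 h0] at h
      exact h (by simpa using collinear_pair ℝ p b)
    have hcol : ∀ r t : ℝ, r ≠ 0 → r • (b - p) ≠ t • (a - p) :=
      fun r t hr he ↦ h (collinear_of_smul_sub_eq hr he)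
    generalize a - p = u at *
    generalize b - p = v at *
    generalize s - p = w at *
    let n : Pt3 := !₂[u 1 * v 2 - u 2 * v 1, u 2 * v 0 - u 0 * v 2, u 0 * v 1 - u 1 * v 0]
    have hn : n ≠ 0 := by
      intro hn
      have h0 : u 1 * v 2 - u 2 * v 1 = 0 := congrArg (fun z : Pt3 ↦ z 0) hn
      have h1 : u 2 * v 0 - u 0 * v 2 = 0 := congrArg (fun z : Pt3 ↦ z 1) hn
      have h2 : u 0 * v 1 - u 1 * v 0 = 0 := congrArg (fun z : Pt3 ↦ z 2) hn
      refine hcol (dot3 u u) (dot3 u v) (dot3_self_pos hu).ne' ?_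
      ext i
      fin_cases i <;> simp [dot3]
      · linear_combination u 2 * h1 - u 1 * h2
      · linear_combination u 0 * h2 - u 2 * h0
      · linear_combination u 1 * h0 - u 0 * h1
    have hN := (dot3_self_pos hn).ne'
    refine ⟨det3 w v n / dot3 n n, det3 u w n / dot3 n n, ?_⟩
    have key : (dot3 n n) • w = det3 w v n • u + det3 u w n • v := by
      unfold det3 at hdet
      ext i
      fin_cases i <;> simp [det3, dot3, n]
      · linear_combination (u 1 * v 2 - u 2 * v 1) * hdet
      · linear_combination (u 2 * v 0 - u 0 * v 2) * hdet
      · linear_combination (u 0 * v 1 - u 1 * v 0) * hdet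
    rw [div_eq_inv_mul, div_eq_inv_mul, mul_smul, mul_smul, ← smul_add, ← key, smul_smul,
      inv_mul_cancel₀ hN, one_smul]

/-- Central projection from `p`: in suitable coordinates of the image plane, the first coordinates
of the images of the points of `T` are distinct. -/
theorem exists_projection {p : Pt3} {T : Finset Pt3} (hT : T.Nontrivial)
    (hp : ∀ a ∈ T, a ≠ p) (hc : ∀ a ∈ T, ∀ b ∈ T, a ≠ b → ¬ Collinear ℝ {p, a, b}) :
    ∃ x y : Pt3 → ℝ, InjOn x T ∧ ∀ a ∈ T, ∀ b ∈ T, ∀ c ∈ T,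
      (Melchior.orient x y a b c = 0 ↔ det3 (a - p) (b - p) (c - p) = 0) := by
  obtain ⟨φ, hφ⟩ := exists_dot3_ne_zero (fun a : T ↦ a.1 - p) fun a ↦ sub_ne_zero.2 (hp a a.2)
  have hφ : ∀ a ∈ T, dot3 φ (a - p) ≠ 0 := fun a ha ↦ hφ ⟨a, ha⟩
  obtain ⟨ψ, hψ⟩ := exists_dot3_ne_zero
    (fun ab : T.offDiag ↦ dot3 φ (ab.1.1 - p) • (ab.1.2 - p) - dot3 φ (ab.1.2 - p) • (ab.1.1 - p))
    (by
      rintro ⟨⟨a, b⟩, hab⟩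
      rw [Finset.mem_offDiag] at hab
      exact fun h ↦ hc a hab.1 b hab.2.1 hab.2.2
        (collinear_of_smul_sub_eq (hφ a hab.1) (sub_eq_zero.1 h)))
  have hψ : ∀ a ∈ T, ∀ b ∈ T, a ≠ b →
      dot3 φ (a - p) * dot3 ψ (b - p) - dot3 φ (b - p) * dot3 ψ (a - p) ≠ 0 := by
    intro a ha b hb hab h
    refine hψ ⟨(a, b), Finset.mem_offDiag.2 ⟨ha, hb, hab⟩⟩ ?_
    rw [← h]
    simp only [dot3, PiLp.sub_apply, PiLp.smul_apply, smul_eq_mul]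
    ring
  let χ : Pt3 := !₂[φ 1 * ψ 2 - φ 2 * ψ 1, φ 2 * ψ 0 - φ 0 * ψ 2, φ 0 * ψ 1 - φ 1 * ψ 0]
  have hχ : χ ≠ 0 := by
    intro hχ
    have h0 : φ 1 * ψ 2 - φ 2 * ψ 1 = 0 := congrArg (fun z : Pt3 ↦ z 0) hχ
    have h1 : φ 2 * ψ 0 - φ 0 * ψ 2 = 0 := congrArg (fun z : Pt3 ↦ z 1) hχ
    have h2 : φ 0 * ψ 1 - φ 1 * ψ 0 = 0 := congrArg (fun z : Pt3 ↦ z 2) hχ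
    obtain ⟨a, ha, b, hb, hab⟩ := hT
    apply hψ a ha b hb hab
    generalize a - p = u
    generalize b - p = v
    unfold dot3
    linear_combination (u 1 * v 2 - u 2 * v 1) * h0 + (u 2 * v 0 - u 0 * v 2) * h1 +
      (u 0 * v 1 - u 1 * v 0) * h2
  have hK := (dot3_self_pos hχ).ne'
  refine ⟨fun a ↦ dot3 ψ (a - p) / dot3 φ (a - p), fun a ↦ dot3 χ (a - p) / dot3 φ (a - p),
    ?_, ?_⟩
  · intro a ha b hb h
    by_contra hab
    apply hψ a ha b hb hab
    have := (div_eq_div_iff (hφ a ha) (hφ b hb)).1 h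
    linarith
  · intro a ha b hb c hc
    have ha := hφ a ha
    have hb := hφ b hb
    have hc := hφ c hc
    simp only [Melchior.orient]
    generalize a - p = u at *
    generalize b - p = v at *
    generalize c - p = w at *
    have h1 : dot3 φ u * (dot3 ψ v * dot3 χ w - dot3 χ v * dot3 ψ w)
        - dot3 ψ u * (dot3 φ v * dot3 χ w - dot3 χ v * dot3 φ w)
        + dot3 χ u * (dot3 φ v * dot3 ψ w - dot3 ψ v * dot3 φ w)
        = dot3 χ χ * det3 u v w := by
      simp [dot3, det3, χ]
      ring
    have h2 : (dot3 ψ v / dot3 φ v - dot3 ψ u / dot3 φ u) *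
          (dot3 χ w / dot3 φ w - dot3 χ u / dot3 φ u) -
        (dot3 χ v / dot3 φ v - dot3 χ u / dot3 φ u) *
          (dot3 ψ w / dot3 φ w - dot3 ψ u / dot3 φ u) =
        dot3 χ χ * det3 u v w / (dot3 φ u * dot3 φ v * dot3 φ w) := by
      rw [← h1]
      field_simp
      ring
    rw [h2]
    simp [ha, hb, hc, hK]

theorem NoThreeCollinear.not_collinear {S : Set Pt3} (h : NoThreeCollinear S) {a b c : Pt3}
    (ha : a ∈ S) (hb : b ∈ S) (hc : c ∈ S) (hab : a ≠ b) (hac : a ≠ c) (hbc : b ≠ c) :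
    ¬ Collinear ℝ {a, b, c} :=
  h _ (by simp [insert_subset_iff, ha, hb, hc]) (ncard_eq_three.2 ⟨a, b, c, hab, hac, hbc, rfl⟩)

theorem isPlane_affineSpan {a b c : Pt3} (h : ¬ Collinear ℝ {a, b, c}) :
    IsPlane (affineSpan ℝ {a, b, c}) :=
  ⟨a, b, c, affineIndependent_iff_not_collinear_set.2 h, rfl⟩

theorem IsPlane.eq_affineSpan {P : Set Pt3} (hP : IsPlane P) {a b c : Pt3} (ha : a ∈ P)
    (hb : b ∈ P) (hc : c ∈ P) (h : ¬ Collinear ℝ {a, b, c}) : P = affineSpan ℝ {a, b, c} := by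
  obtain ⟨a', b', c', hi', rfl⟩ := hP
  have hi := affineIndependent_iff_not_collinear_set.2 h
  have hr (a b c : Pt3) : Set.range ![a, b, c] = {a, b, c} := by
    simp only [Matrix.range_cons, Matrix.range_empty, union_empty, singleton_union]
  have hle : affineSpan ℝ (Set.range ![a, b, c]) ≤ affineSpan ℝ {a', b', c'} := by
    rw [hr, affineSpan_le]
    simpa only [insert_subset_iff, singleton_subset_iff] using ⟨ha, hb, hc⟩
  have hd : Module.finrank ℝ (affineSpan ℝ {a', b', c'}).direction = 2 := by
    rw [direction_affineSpan, ← hr]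
    exact hi'.finrank_vectorSpan (by simp)
  have := hi.affineSpan_eq_of_le_of_card_eq_finrank_add_one hle (by simp [hd])
  rw [← this, hr]

section Count

variable {S : Set Pt3}

theorem exists_pair_of_mem_detPlanes (hS : S.Finite) {P : Set Pt3} (hP : P ∈ detPlanes S)
    {p : Pt3} (hpS : p ∈ S) (hp : p ∈ P) :
    ∃ a ∈ S, ∃ b ∈ S, a ∈ P ∧ b ∈ P ∧ a ≠ p ∧ b ≠ p ∧ a ≠ b := by
  have h : 1 < ((S ∩ P) \ {p}).ncard := by
    rw [ncard_sdiff_singleton_of_mem (show p ∈ S ∩ P from ⟨hpS, hp⟩)]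
    have := hP.2
    omega
  obtain ⟨a, ha, b, hb, hab⟩ := (one_lt_ncard ((hS.inter_of_left P).sdiff)).1 h
  exact ⟨a, ha.1.1, b, hb.1.1, ha.1.2, hb.1.2, ha.2, hb.2, hab⟩

theorem finite_detPlanes (hS : S.Finite) (h3 : NoThreeCollinear S) : (detPlanes S).Finite := by
  refine Set.Finite.of_finite_image (f := fun P ↦ S ∩ P)
    (hS.finite_subsets.subset ?_) ?_
  · rintro _ ⟨P, -, rfl⟩
    exact inter_subset_left
  · intro P hP Q hQ h
    obtain ⟨p, hpS, hp⟩ := nonempty_of_ncard_ne_zero (s := S ∩ P) (by have := hP.2; omega)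
    obtain ⟨a, ha, b, hb, haP, hbP, hap, hbp, hab⟩ := exists_pair_of_mem_detPlanes hS hP hpS hp
    have hQ' : ∀ s ∈ S, s ∈ P → s ∈ Q := fun s hs hsP ↦ (h.subset ⟨hs, hsP⟩).2
    have hnc := h3.not_collinear hpS ha hb hap.symm hbp.symm hab
    rw [hP.1.eq_affineSpan hp haP hbP hnc,
      hQ.1.eq_affineSpan (hQ' p hpS hp) (hQ' a ha haP) (hQ' b hb hbP) hnc]

/-- Melchior's inequality for the projection of `S` from one of its points `p`: the sum of
`4 - k` over the planes through `p`, `k` being the number of points of the plane, is at least `3`. -/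
theorem three_le_sum_planes_through (hS : S.Finite) (h3 : NoThreeCollinear S)
    (hpl : ¬ Coplanar ℝ S) {D : Finset (Set Pt3)} {p : Pt3} (hp : p ∈ S)
    (hD : ∀ P, P ∈ D ↔ P ∈ detPlanes S ∧ p ∈ P) :
    (3 : ℝ) ≤ ∑ P ∈ D, (4 - ((S ∩ P).ncard : ℝ)) := by
  classical
  let T : Finset Pt3 := hS.toFinset.erase p
  have memT (s) : s ∈ T ↔ s ≠ p ∧ s ∈ S := by simp [T]
  have hnc : ∀ a ∈ T, ∀ b ∈ T, a ≠ b → ¬ Collinear ℝ {p, a, b} := by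
    intro a ha b hb hab
    rw [memT] at ha hb
    exact h3.not_collinear hp ha.2 hb.2 ha.1.symm hb.1.symm hab
  have hTn : T.Nontrivial := by
    by_contra hT
    replace hT : (T : Set Pt3).Subsingleton := Set.not_nontrivial_iff.1 hT
    apply hpl
    by_cases h : ∃ a, a ∈ T
    · obtain ⟨a, ha⟩ := h
      refine (coplanar_pair ℝ p a).subset fun s hs ↦ ?_
      by_cases hsp : s = p
      · simp [hsp]
      · simp [hT ((memT s).2 ⟨hsp, hs⟩) ha]
    · refine (coplanar_singleton ℝ p).subset fun s hs ↦ ?_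
      by_contra hsp
      exact h ⟨s, (memT s).2 ⟨hsp, hs⟩⟩
  obtain ⟨x, y, hx, hxy⟩ := exists_projection hTn (fun a ha ↦ ((memT a).1 ha).1) hnc
  have memspan {a b c} (ha : a ∈ T) (hb : b ∈ T) (hc : c ∈ T) (hab : a ≠ b) :
      c ∈ (affineSpan ℝ {p, a, b} : Set Pt3) ↔ Melchior.orient x y a b c = 0 := by
    rw [hxy a ha b hb c hc, SetLike.mem_coe, mem_affineSpan_triple_iff (hnc a ha b hb hab)]
  have hT3 : ∃ a ∈ T, ∃ b ∈ T, ∃ c ∈ T, Melchior.orient x y a b c ≠ 0 := by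
    by_contra! hall
    obtain ⟨a, ha, b, hb, hab⟩ := hTn
    apply hpl
    have hcop : Coplanar ℝ (affineSpan ℝ {p, a, b} : Set Pt3) := by
      have := coplanar_triple ℝ p a b
      rwa [Coplanar, ← direction_affineSpan, ← AffineSubspace.affineSpan_coe (affineSpan ℝ {p, a, b}),
        direction_affineSpan] at this
    refine hcop.subset fun s hs ↦ ?_
    by_cases hsp : s = p
    · rw [hsp]; exact subset_affineSpan ℝ _ (by simp)
    · have hsT := (memT s).2 ⟨hsp, hs⟩
      exact (memspan ha hb hsT hab).2 (hall a ha b hb s hsT)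
  let F : Set Pt3 → Finset Pt3 := fun P ↦ {s ∈ T | s ∈ P}
  have hF (P) (hP : P ∈ D) : ∃ a ∈ T, ∃ b ∈ T, a ≠ b ∧ a ∈ P ∧ b ∈ P ∧
      P = affineSpan ℝ {p, a, b} := by
    rw [hD] at hP
    obtain ⟨a, ha, b, hb, haP, hbP, hap, hbp, hab⟩ :=
      exists_pair_of_mem_detPlanes hS hP.1 hp hP.2
    have haT := (memT a).2 ⟨hap, ha⟩
    have hbT := (memT b).2 ⟨hbp, hb⟩
    exact ⟨a, haT, b, hbT, hab, haP, hbP, hP.1.1.eq_affineSpan hP.2 haP hbP (hnc a haT b hbT hab)⟩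
  have hFinj : Set.InjOn F D := by
    intro P hP Q hQ h
    obtain ⟨a, ha, b, hb, hab, haP, hbP, hPe⟩ := hF P hP
    have haQ : a ∈ F Q := h ▸ Finset.mem_filter.2 ⟨ha, haP⟩
    have hbQ : b ∈ F Q := h ▸ Finset.mem_filter.2 ⟨hb, hbP⟩
    rw [Finset.mem_coe, hD] at hQ
    rw [hPe, hQ.1.1.eq_affineSpan hQ.2 (Finset.mem_filter.1 haQ).2 (Finset.mem_filter.1 hbQ).2
      (hnc a ha b hb hab)]
  have hFspan {a b} (ha : a ∈ T) (hb : b ∈ T) (hab : a ≠ b) :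
      F (affineSpan ℝ {p, a, b}) = Melchior.lineThrough x y T a b :=
    Finset.filter_congr fun c hc ↦ memspan ha hb hc hab
  have hlines : Melchior.lines x y T = D.image F := by
    ext l
    simp only [Melchior.lines, Finset.mem_image, Finset.mem_offDiag, Prod.exists]
    constructor
    · rintro ⟨a, b, ⟨ha, hb, hab⟩, rfl⟩
      refine ⟨affineSpan ℝ {p, a, b}, (hD _).2 ⟨⟨isPlane_affineSpan (hnc a ha b hb hab), ?_⟩, ?_⟩,
        hFspan ha hb hab⟩
      · have h := ncard_eq_three.2
          ⟨p, a, b, ((memT a).1 ha).1.symm, ((memT b).1 hb).1.symm, hab, rfl⟩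
        refine h.ge.trans <| ncard_le_ncard (subset_inter ?_ (subset_affineSpan ℝ _)) (hS.inter_of_left _)
        simp [insert_subset_iff, hp, ((memT a).1 ha).2, ((memT b).1 hb).2]
      · exact subset_affineSpan ℝ _ (by simp)
    · rintro ⟨P, hP, rfl⟩
      obtain ⟨a, ha, b, hb, hab, -, -, hPe⟩ := hF P hP
      exact ⟨a, b, ⟨ha, hb, hab⟩, by rw [hPe, hFspan ha hb hab]⟩
  have hcard (P) (hP : P ∈ D) : ((S ∩ P).ncard : ℝ) = ((F P).card - 1 : ℕ) + 2 := by
    rw [hD] at hP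
    have h1 : (F P : Set Pt3) = (S ∩ P) \ {p} := by
      ext s
      simp only [F, Finset.coe_filter, memT, mem_ofPred_eq, mem_sdiff, mem_inter_iff,
        mem_singleton_iff]
      tauto
    have h2 := ncard_sdiff_singleton_of_mem (s := S ∩ P) ⟨hp, hP.2⟩
    rw [← h1, ncard_coe_finset] at h2
    have := hP.1.2
    have h3 : (S ∩ P).ncard = ((F P).card - 1) + 2 := by omega
    exact_mod_cast h3
  have hM := Melchior.melchior hx hT3
  rw [hlines, Finset.sum_image hFinj, Finset.card_image_of_injOn hFinj] at hM
  have hM' : (∑ P ∈ D, (((F P).card - 1 : ℕ) : ℝ)) + 3 ≤ 2 * D.card := by exact_mod_cast hM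
  have : ∑ P ∈ D, (4 - ((S ∩ P).ncard : ℝ)) =
      2 * D.card - ∑ P ∈ D, (((F P).card - 1 : ℕ) : ℝ) := by
    rw [Finset.sum_congr rfl fun P hP ↦ by rw [hcard P hP], mul_comm, ← nsmul_eq_mul,
      ← Finset.sum_const, ← Finset.sum_sub_distrib]
    exact Finset.sum_congr rfl fun P _ ↦ by ring
  linarith

end Count

theorem stmt8 (S : Set Pt3) (hS : S.Finite) (n : ℕ) (hn : S.ncard = n)
    (h3 : NoThreeCollinear S) (hpl : ¬ Coplanar ℝ S) :
    ((planeCount S 3 + planeCount S 4 : ℕ) : ℝ) ≥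
      (5 * ((detPlanes S).ncard : ℝ) + 3 * n) / 8 := by
  classical
  have hfin := finite_detPlanes hS h3
  set D := hfin.toFinset with hDdef
  have hD (P) : P ∈ D ↔ P ∈ detPlanes S := hfin.mem_toFinset
  have hcount {k : ℕ} (hk : 3 ≤ k) : planeCount S k = ∑ P ∈ D, if (S ∩ P).ncard = k then 1 else 0 := by
    rw [← Finset.card_filter, planeCount, ← ncard_coe_finset]
    congr 1
    ext P
    simp only [Finset.coe_filter, hD, detPlanes, mem_ofPred_eq]
    constructor
    · rintro ⟨h1, h2⟩; exact ⟨⟨h1, by omega⟩, h2⟩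
    · rintro ⟨⟨h1, -⟩, h2⟩; exact ⟨h1, h2⟩
  have hm : ((detPlanes S).ncard : ℝ) = ∑ P ∈ D, 1 := by
    rw [ncard_eq_toFinset_card _ hfin]; simp [hDdef]
  have hsum : (3 * n : ℝ) ≤ ∑ P ∈ D, ((S ∩ P).ncard : ℝ) * (4 - (S ∩ P).ncard) := by
    calc (3 * n : ℝ) = ∑ p ∈ hS.toFinset, 3 := by
          rw [← hn, ncard_eq_toFinset_card _ hS]; simp [mul_comm]
      _ ≤ ∑ p ∈ hS.toFinset, ∑ P ∈ D with p ∈ P, (4 - ((S ∩ P).ncard : ℝ)) := by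
          refine Finset.sum_le_sum fun p hp ↦ ?_
          exact three_le_sum_planes_through hS h3 hpl (hS.mem_toFinset.1 hp) fun P ↦ by simp [hD]
      _ = ∑ P ∈ D, ∑ p ∈ hS.toFinset with p ∈ P, (4 - ((S ∩ P).ncard : ℝ)) := by
          simp only [Finset.sum_filter]
          exact Finset.sum_comm
      _ = _ := by
          refine Finset.sum_congr rfl fun P _ ↦ ?_
          have : ((hS.toFinset.filter (· ∈ P) : Finset Pt3) : Set Pt3) = S ∩ P := by ext; simp
          rw [Finset.sum_const, nsmul_eq_mul, ← this, ncard_coe_finset]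
  have hle : ∑ P ∈ D, ((S ∩ P).ncard : ℝ) * (4 - (S ∩ P).ncard) ≤
      8 * ((planeCount S 3 + planeCount S 4 : ℕ) : ℝ) - 5 * ((detPlanes S).ncard : ℝ) := by
    rw [hm, hcount le_rfl, hcount (by norm_num : 3 ≤ 4), ← Finset.sum_add_distrib]
    push_cast
    rw [Finset.mul_sum, Finset.mul_sum, ← Finset.sum_sub_distrib]
    refine Finset.sum_le_sum fun P hP ↦ ?_
    have hk := ((hD P).1 hP).2
    generalize (S ∩ P).ncard = k at hk
    rcases (by omega : k = 3 ∨ k = 4 ∨ 5 ≤ k) with rfl | rfl | h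
    · norm_num
    · norm_num
    · have h5 : (5 : ℝ) ≤ k := by exact_mod_cast h
      rw [if_neg (by omega), if_neg (by omega)]
      nlinarith
  linarith
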